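/- arXiv:0711.0073 — 5 statements merged into one kernel-verified Lean document; each statement's English description precedes it below -/
import Mathlib

section
/- The series Σ (−1)^{ν₁+ν₂+ν₃} · μ₁^{−5/4}ν₁^{−1/4} μ₂^{−5/4}ν₂^{−1/4} μ₃^{−5/4}ν₃^{−1/4}, where the sum runs over all sextuples of positive integers (μ₁,ν₁,μ₂,ν₂,μ₃,ν₃) with 0 < ν_j < μ_j and μ_j ≡ ν_j (mod 2) for j = 1,2,3 and satisfying √(μ₁ν₁) + √(μ₂ν₂) = √(μ₃ν₃), converges absolutely and its sum is strictly positive. -/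
open scoped Classical
open Real

/-- The general term of the series: for a sextuple `(μ₁,ν₁,μ₂,ν₂,μ₃,ν₃)` of positive
integers with `0 < ν_j < μ_j`, `μ_j ≡ ν_j (mod 2)` and `√(μ₁ν₁)+√(μ₂ν₂)=√(μ₃ν₃)`
it equals `(−1)^{ν₁+ν₂+ν₃} ∏ μ_j^{−5/4} ν_j^{−1/4}`, and it is `0` otherwise. -/
noncomputable def seriesTerm (p : (ℕ × ℕ) × (ℕ × ℕ) × (ℕ × ℕ)) : ℝ :=
  if 0 < p.1.2 ∧ p.1.2 < p.1.1 ∧ p.1.1 % 2 = p.1.2 % 2 ∧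
     0 < p.2.1.2 ∧ p.2.1.2 < p.2.1.1 ∧ p.2.1.1 % 2 = p.2.1.2 % 2 ∧
     0 < p.2.2.2 ∧ p.2.2.2 < p.2.2.1 ∧ p.2.2.1 % 2 = p.2.2.2 % 2 ∧
     Real.sqrt ((p.1.1 : ℝ) * p.1.2) + Real.sqrt ((p.2.1.1 : ℝ) * p.2.1.2) =
       Real.sqrt ((p.2.2.1 : ℝ) * p.2.2.2) then
    (-1 : ℝ) ^ (p.1.2 + p.2.1.2 + p.2.2.2) *
      ((p.1.1 : ℝ) ^ (-(5 : ℝ) / 4) * (p.1.2 : ℝ) ^ (-(1 : ℝ) / 4)) *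
      ((p.2.1.1 : ℝ) ^ (-(5 : ℝ) / 4) * (p.2.1.2 : ℝ) ^ (-(1 : ℝ) / 4)) *
      ((p.2.2.1 : ℝ) ^ (-(5 : ℝ) / 4) * (p.2.2.2 : ℝ) ^ (-(1 : ℝ) / 4))
  else 0

theorem add_one_pow_three_le (e : ℕ) : (e + 1) ^ 3 ≤ 8 * 2 ^ e := by
  rcases lt_or_ge e 4 with h | h
  · interval_cases e <;> norm_num
  · induction e, h using Nat.le_induction with
    | base => norm_num
    | succ n hn ih => rw [pow_succ 2]; nlinarith [mul_le_mul hn hn (by norm_num) (by omega)]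

theorem card_divisors_pow_three_le {n : ℕ} (hn : n ≠ 0) :
    n.divisors.card ^ 3 ≤ 8 ^ 8 * n := by
  have h8 : ∏ p ∈ n.primeFactors, (if p < 8 then 8 else 1) ≤ 8 ^ 8 := by
    rw [← Finset.prod_filter, Finset.prod_const]
    refine Nat.pow_le_pow_right (by norm_num) ?_
    refine (Finset.card_le_card (t := Finset.range 8) fun p hp => ?_).trans_eq (by simp)
    simp only [Finset.mem_filter] at hp
    simpa using hp.2
  calc n.divisors.card ^ 3 = ∏ p ∈ n.primeFactors, (n.factorization p + 1) ^ 3 := by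
        rw [Nat.card_divisors hn, Finset.prod_pow]
    _ ≤ ∏ p ∈ n.primeFactors, ((if p < 8 then 8 else 1) * p ^ n.factorization p) := by
        refine Finset.prod_le_prod' fun p hp => ?_
        have hp2 := (Nat.prime_of_mem_primeFactors hp).two_le
        split_ifs with h
        · exact (add_one_pow_three_le _).trans
            (Nat.mul_le_mul_left _ (Nat.pow_le_pow_left hp2 _))
        · calc (n.factorization p + 1) ^ 3 ≤ (2 ^ n.factorization p) ^ 3 :=
                Nat.pow_le_pow_left Nat.lt_two_pow_self _
            _ = 8 ^ n.factorization p := by rw [← pow_mul, mul_comm, pow_mul]; norm_num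
            _ ≤ 1 * p ^ n.factorization p := by
                rw [one_mul]; exact Nat.pow_le_pow_left (by omega) _
    _ ≤ 8 ^ 8 * n := by
        rw [Finset.prod_mul_distrib]
        have h : ∏ p ∈ n.primeFactors, p ^ n.factorization p = n :=
          Nat.prod_factorization_pow_eq_self hn
        rw [h]
        exact Nat.mul_le_mul_right _ h8

theorem card_divisorsAntidiagonal_eq (n : ℕ) :
    n.divisorsAntidiagonal.card = n.divisors.card := by
  rw [← Nat.map_div_right_divisors, Finset.card_map]

theorem exists_of_sqrt_add_sqrt_eq {a b c : ℕ} (h : √(a : ℝ) + √(b : ℝ) = √(c : ℝ)) :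
    ∃ k : ℕ, c = a + b + 2 * k ∧ a * b = k ^ 2 := by
  have ha := Real.sq_sqrt (Nat.cast_nonneg (α := ℝ) a)
  have hb := Real.sq_sqrt (Nat.cast_nonneg (α := ℝ) b)
  have hc := Real.sq_sqrt (Nat.cast_nonneg (α := ℝ) c)
  have hab := mul_nonneg (Real.sqrt_nonneg (a : ℝ)) (Real.sqrt_nonneg (b : ℝ))
  rw [← h] at hc
  have hle : a + b ≤ c := by
    have : (a : ℝ) + b ≤ c := by nlinarith
    exact_mod_cast this
  obtain ⟨d, rfl⟩ := Nat.exists_eq_add_of_le hle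
  have hd : d ^ 2 = 4 * (a * b) := by
    have h1 : (d : ℝ) = 2 * (√(a : ℝ) * √(b : ℝ)) := by push_cast at hc; linarith
    have h2 : (d : ℝ) ^ 2 = 4 * (a * b) := by
      rw [h1]; calc _ = 4 * (√(a : ℝ) ^ 2 * √(b : ℝ) ^ 2) := by ring
        _ = _ := by rw [ha, hb]
    exact_mod_cast h2
  have hev : 2 ∣ d := Nat.prime_two.dvd_of_dvd_pow (n := 2) (by omega)
  obtain ⟨k, rfl⟩ := hev
  exact ⟨k, rfl, by nlinarith⟩

theorem exists_common_sqrt_part {a b c : ℕ} (ha : 0 < a)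
    (h : √(a : ℝ) + √(b : ℝ) = √(c : ℝ)) :
    ∃ r m n : ℕ, a = r * m ^ 2 ∧ b = r * n ^ 2 ∧ c = r * (m + n) ^ 2 := by
  obtain ⟨k, rfl, hk⟩ := exists_of_sqrt_add_sqrt_eq h
  obtain ⟨g, x, y, hg, hxy, rfl, rfl⟩ := Nat.exists_coprime' (Nat.gcd_pos_of_pos_left b ha)
  have hgk : g ∣ k := by
    rw [← Nat.pow_dvd_pow_iff two_ne_zero, ← hk]
    exact ⟨x * y, by ring⟩
  obtain ⟨l, rfl⟩ := hgk
  have hl : x * y = l ^ 2 := by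
    have : g ^ 2 * (x * y) = g ^ 2 * l ^ 2 := by nlinarith
    exact Nat.eq_of_mul_eq_mul_left (by positivity) this
  obtain ⟨m, rfl⟩ := exists_eq_pow_of_mul_eq_pow (Nat.isUnit_iff.2 hxy) hl
  obtain ⟨n, rfl⟩ := exists_eq_pow_of_mul_eq_pow (Nat.isUnit_iff.2 hxy.symm)
    (by rw [mul_comm]; exact hl)
  have hmn : m * n = l := by
    rw [← mul_pow] at hl
    exact Nat.pow_left_injective two_ne_zero hl
  exact ⟨g, m, n, by ring, by ring, by rw [← hmn]; ring⟩

theorem rpow_mul_rpow_le {a b : ℕ} (hb : 0 < b) (hab : b < a) :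
    (a : ℝ) ^ (-(5 : ℝ) / 4) * (b : ℝ) ^ (-(1 : ℝ) / 4) ≤ ((a * b : ℕ) : ℝ) ^ (-(3 : ℝ) / 4) := by
  have hb' : (0 : ℝ) < b := by exact_mod_cast hb
  have hab' : (b : ℝ) ≤ a := by exact_mod_cast hab.le
  have ha' : (0 : ℝ) < a := hb'.trans_le hab'
  have h := Real.rpow_le_rpow_of_nonpos hb' hab' (z := -(1 : ℝ) / 2) (by norm_num)
  calc (a : ℝ) ^ (-(5 : ℝ) / 4) * (b : ℝ) ^ (-(1 : ℝ) / 4)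
      = (a : ℝ) ^ (-(3 : ℝ) / 4) * (a : ℝ) ^ (-(1 : ℝ) / 2) * (b : ℝ) ^ (-(1 : ℝ) / 4) := by
        rw [← Real.rpow_add ha']; norm_num
    _ ≤ (a : ℝ) ^ (-(3 : ℝ) / 4) * (b : ℝ) ^ (-(1 : ℝ) / 2) * (b : ℝ) ^ (-(1 : ℝ) / 4) := by
        gcongr
    _ = ((a * b : ℕ) : ℝ) ^ (-(3 : ℝ) / 4) := by
        rw [mul_assoc, ← Real.rpow_add hb']
        push_cast
        rw [Real.mul_rpow ha'.le hb'.le]; norm_num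

/-- The index set of the series. -/
def Admissible (p : (ℕ × ℕ) × (ℕ × ℕ) × (ℕ × ℕ)) : Prop :=
  0 < p.1.2 ∧ p.1.2 < p.1.1 ∧ p.1.1 % 2 = p.1.2 % 2 ∧
     0 < p.2.1.2 ∧ p.2.1.2 < p.2.1.1 ∧ p.2.1.1 % 2 = p.2.1.2 % 2 ∧
     0 < p.2.2.2 ∧ p.2.2.2 < p.2.2.1 ∧ p.2.2.1 % 2 = p.2.2.2 % 2 ∧
     Real.sqrt ((p.1.1 : ℝ) * p.1.2) + Real.sqrt ((p.2.1.1 : ℝ) * p.2.1.2) =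
       Real.sqrt ((p.2.2.1 : ℝ) * p.2.2.2)

theorem seriesTerm_of_not_admissible {p : (ℕ × ℕ) × (ℕ × ℕ) × (ℕ × ℕ)} (hp : ¬ Admissible p) :
    seriesTerm p = 0 :=
  if_neg hp

theorem mul_mod_two_of_mod_two_eq {a b : ℕ} (h : a % 2 = b % 2) : a * b % 2 = b % 2 := by
  rw [Nat.mul_mod, h]
  rcases Nat.mod_two_eq_zero_or_one b with h | h <;> simp [h]

/-- On the index set the sign is always positive. -/
theorem seriesTerm_of_admissible {p : (ℕ × ℕ) × (ℕ × ℕ) × (ℕ × ℕ)} (hp : Admissible p) :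
    seriesTerm p =
      ((p.1.1 : ℝ) ^ (-(5 : ℝ) / 4) * (p.1.2 : ℝ) ^ (-(1 : ℝ) / 4)) *
      ((p.2.1.1 : ℝ) ^ (-(5 : ℝ) / 4) * (p.2.1.2 : ℝ) ^ (-(1 : ℝ) / 4)) *
      ((p.2.2.1 : ℝ) ^ (-(5 : ℝ) / 4) * (p.2.2.2 : ℝ) ^ (-(1 : ℝ) / 4)) := by
  have h : seriesTerm p = _ := if_pos hp
  obtain ⟨-, -, h1, -, -, h2, -, -, h3, hs⟩ := hp
  obtain ⟨k, hk, -⟩ := exists_of_sqrt_add_sqrt_eq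
    (a := p.1.1 * p.1.2) (b := p.2.1.1 * p.2.1.2) (c := p.2.2.1 * p.2.2.2)
    (by push_cast; exact hs)
  have hev : Even (p.1.2 + p.2.1.2 + p.2.2.2) := by
    have := mul_mod_two_of_mod_two_eq h1
    have := mul_mod_two_of_mod_two_eq h2
    have := mul_mod_two_of_mod_two_eq h3
    rw [Nat.even_iff]
    omega
  rw [h, hev.neg_one_pow, one_mul]

theorem seriesTerm_nonneg (p : (ℕ × ℕ) × (ℕ × ℕ) × (ℕ × ℕ)) : 0 ≤ seriesTerm p := by
  by_cases hp : Admissible p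
  · rw [seriesTerm_of_admissible hp]; positivity
  · rw [seriesTerm_of_not_admissible hp]

/-- The product of the three integers `r m²`, `r n²`, `r (m + n)²`. -/
def tripleProd (k : ℕ × ℕ × ℕ) : ℕ :=
  (k.1 * k.2.1 ^ 2) * (k.1 * k.2.2 ^ 2) * (k.1 * (k.2.1 + k.2.2) ^ 2)

/-- The factorizations of the three integers `r m²`, `r n²`, `r (m + n)²`. -/
def tripleFactorizations (k : ℕ × ℕ × ℕ) : Finset ((ℕ × ℕ) × (ℕ × ℕ) × (ℕ × ℕ)) :=
  (k.1 * k.2.1 ^ 2).divisorsAntidiagonal ×ˢ (k.1 * k.2.2 ^ 2).divisorsAntidiagonal ×ˢ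
    (k.1 * (k.2.1 + k.2.2) ^ 2).divisorsAntidiagonal

theorem exists_mem_tripleFactorizations {p : (ℕ × ℕ) × (ℕ × ℕ) × (ℕ × ℕ)} (hp : Admissible p) :
    ∃ k, p ∈ tripleFactorizations k ∧ seriesTerm p ≤ (tripleProd k : ℝ) ^ (-(3 : ℝ) / 4) := by
  rw [seriesTerm_of_admissible hp]
  obtain ⟨⟨a, b⟩, ⟨c, d⟩, ⟨e, f⟩⟩ := p
  obtain ⟨b0, hab, -, d0, hcd, -, f0, hef, -, hs⟩ := hp
  dsimp only at *
  have hab0 : 0 < a * b := Nat.mul_pos (b0.trans hab) b0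
  have hcd0 : 0 < c * d := Nat.mul_pos (d0.trans hcd) d0
  have hef0 : 0 < e * f := Nat.mul_pos (f0.trans hef) f0
  obtain ⟨r, m, n, h1, h2, h3⟩ := exists_common_sqrt_part (a := a * b) (b := c * d) (c := e * f)
    hab0 (by push_cast; exact hs)
  refine ⟨(r, m, n), ?_, ?_⟩
  · simp only [tripleFactorizations, Finset.mem_product, Nat.mem_divisorsAntidiagonal,
      ← h1, ← h2, ← h3]
    exact ⟨⟨trivial, hab0.ne'⟩, ⟨trivial, hcd0.ne'⟩, ⟨trivial, hef0.ne'⟩⟩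
  · simp only [tripleProd, ← h1, ← h2, ← h3]
    rw [Nat.cast_mul (a * b * (c * d)), Nat.cast_mul (a * b),
      Real.mul_rpow (by positivity) (by positivity), Real.mul_rpow (by positivity) (by positivity)]
    gcongr
    · exact rpow_mul_rpow_le b0 hab
    · exact rpow_mul_rpow_le d0 hcd
    · exact rpow_mul_rpow_le f0 hef

theorem card_tripleFactorizations_mul_le (k : ℕ × ℕ × ℕ) :
    ((tripleFactorizations k).card : ℝ) * (tripleProd k : ℝ) ^ (-(3 : ℝ) / 4) ≤
      8 ^ 8 * ((k.1 : ℝ) ^ (-(5 : ℝ) / 4) *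
        ((k.2.1 : ℝ) ^ (-(5 : ℝ) / 4) * (k.2.2 : ℝ) ^ (-(5 : ℝ) / 4))) := by
  obtain ⟨r, m, n⟩ := k
  rcases (tripleFactorizations (r, m, n)).eq_empty_or_nonempty with h | ⟨p, hp⟩
  · rw [h, Finset.card_empty, Nat.cast_zero, zero_mul]
    positivity
  simp only [tripleFactorizations, Finset.mem_product, Nat.mem_divisorsAntidiagonal] at hp
  obtain ⟨⟨-, h1⟩, ⟨-, h2⟩, ⟨-, h3⟩⟩ := hp
  have hr : 0 < r := Nat.pos_of_ne_zero fun h => h1 (by simp [h])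
  have hm : 0 < m := Nat.pos_of_ne_zero fun h => h1 (by simp [h])
  have hn : 0 < n := Nat.pos_of_ne_zero fun h => h2 (by simp [h])
  have hN : 0 < tripleProd (r, m, n) := by unfold tripleProd; positivity
  have hD : (tripleFactorizations (r, m, n)).card ^ 3 ≤ (8 ^ 8) ^ 3 * tripleProd (r, m, n) := by
    simp only [tripleFactorizations, Finset.card_product, card_divisorsAntidiagonal_eq, tripleProd]
    calc _ = _ := by rw [mul_pow, mul_pow, ← mul_assoc]
      _ ≤ _ := Nat.mul_le_mul (Nat.mul_le_mul (card_divisors_pow_three_le h1)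
        (card_divisors_pow_three_le h2)) (card_divisors_pow_three_le h3)
      _ = _ := by ring
  have hle : (r * (m * n)) ^ 3 ≤ tripleProd (r, m, n) := by
    have hmn : m * n ≤ (m + n) ^ 2 := by nlinarith
    calc (r * (m * n)) ^ 3 = (r * m ^ 2) * (r * n ^ 2) * (r * (m * n)) := by ring
      _ ≤ _ := by unfold tripleProd; dsimp only; gcongr
  generalize tripleProd (r, m, n) = N at *
  generalize (tripleFactorizations (r, m, n)).card = D at *
  have hN' : (0 : ℝ) < N := by exact_mod_cast hN
  have hD' : (D : ℝ) ≤ 8 ^ 8 * (N : ℝ) ^ ((1 : ℝ) / 3) := by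
    refine le_of_pow_le_pow_left₀ (n := 3) (by norm_num) (by positivity) ?_
    rw [mul_pow, ← Real.rpow_natCast ((N : ℝ) ^ ((1 : ℝ) / 3)), ← Real.rpow_mul hN'.le]
    norm_num
    norm_num at hD
    exact_mod_cast hD
  calc (D : ℝ) * (N : ℝ) ^ (-(3 : ℝ) / 4)
      ≤ 8 ^ 8 * (N : ℝ) ^ ((1 : ℝ) / 3) * (N : ℝ) ^ (-(3 : ℝ) / 4) := by gcongr
    _ = 8 ^ 8 * (N : ℝ) ^ (-(5 : ℝ) / 12) := by
        rw [mul_assoc, ← Real.rpow_add hN']; norm_num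
    _ ≤ 8 ^ 8 * (((r : ℝ) * (m * n)) ^ 3) ^ (-(5 : ℝ) / 12) := by
        gcongr 8 ^ 8 * ?_
        exact Real.rpow_le_rpow_of_nonpos (by positivity) (by exact_mod_cast hle) (by norm_num)
    _ = _ := by
        rw [← Real.rpow_natCast ((r : ℝ) * (m * n)), ← Real.rpow_mul (by positivity),
          ← Real.mul_rpow (by positivity) (by positivity),
          ← Real.mul_rpow (by positivity) (by positivity)]
        norm_num

theorem summable_tripleFactorizations :
    Summable fun x : Σ k, tripleFactorizations k => (tripleProd x.1 : ℝ) ^ (-(3 : ℝ) / 4) := by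
  rw [summable_sigma_of_nonneg fun x => by positivity]
  refine ⟨fun k => Summable.of_finite, ?_⟩
  have hs : Summable fun n : ℕ => (n : ℝ) ^ (-(5 : ℝ) / 4) :=
    Real.summable_nat_rpow.2 (by norm_num)
  have hnn : ∀ n : ℕ, 0 ≤ (n : ℝ) ^ (-(5 : ℝ) / 4) := fun n => by positivity
  have hs2 := hs.mul_of_nonneg hs hnn hnn
  have hs3 := hs.mul_of_nonneg hs2 hnn fun x => mul_nonneg (hnn _) (hnn _)
  refine Summable.of_nonneg_of_le (fun k => tsum_nonneg fun _ => by positivity) (fun k => ?_)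
    (hs3.mul_left (8 ^ 8))
  dsimp only
  rw [tsum_fintype, Finset.sum_const, nsmul_eq_mul, Finset.card_univ, Fintype.card_coe]
  exact card_tripleFactorizations_mul_le k

theorem summable_seriesTerm : Summable seriesTerm := by
  have hsub : Summable (seriesTerm ∘ ((↑) : {p // Admissible p} → _)) := by
    choose k hk hle using fun p : {p // Admissible p} => exists_mem_tripleFactorizations p.2
    let φ : {p // Admissible p} → Σ k, tripleFactorizations k := fun p => ⟨k p, p.1, hk p⟩
    have hφ : Function.Injective φ := fun p q h =>
      Subtype.ext (congrArg (fun x : Σ k, tripleFactorizations k => x.2.1) h)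
    have hcomp := summable_tripleFactorizations.comp_injective hφ
    refine Summable.of_nonneg_of_le (fun p => seriesTerm_nonneg _) (fun p => ?_) hcomp
    simp only [Function.comp_apply, φ]
    exact hle p
  refine (Subtype.val_injective.summable_iff fun p hp => ?_).1 hsub
  exact seriesTerm_of_not_admissible fun h => hp ⟨⟨p, h⟩, rfl⟩

theorem admissible_three_one_six_two : Admissible ((3, 1), (3, 1), (6, 2)) := by
  refine ⟨by norm_num, by norm_num, by norm_num, by norm_num, by norm_num, by norm_num,
    by norm_num, by norm_num, by norm_num, ?_⟩
  have h : √((6 : ℝ) * 2) = 2 * √(3 * 1) := by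
    rw [show (6 : ℝ) * 2 = 2 ^ 2 * (3 * 1) by norm_num, Real.sqrt_mul (by norm_num),
      Real.sqrt_sq (by norm_num)]
  push_cast
  rw [h]
  ring


/-- The series converges absolutely and its sum is strictly positive. -/
theorem series_abs_convergent_and_positive :
    Summable (fun p => |seriesTerm p|) ∧ 0 < ∑' p, seriesTerm p := by
  refine ⟨summable_seriesTerm.abs, summable_seriesTerm.tsum_pos seriesTerm_nonneg
    ((3, 1), (3, 1), (6, 2)) ?_⟩
  rw [seriesTerm_of_admissible admissible_three_one_six_two]
  positivity
end

section
/- If a₁, a₂, a₃ are positive integers with √a₁ + √a₂ = √a₃, then there exist a squarefree positive integer k and positive integers m₁, m₂, m₃ with m₁ + m₂ = m₃ such that a_j = k·m_j² for j = 1, 2, 3. -/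
/-- If `4 * a * (k * c ^ 2)` is a perfect square with `k` squarefree and `c` positive, then
`a` is `k` times a perfect square. -/
theorem Squarefree.exists_eq_mul_sq {k a c t : ℕ} (hk : Squarefree k) (hc : 0 < c)
    (h : 4 * a * (k * c ^ 2) = t ^ 2) : ∃ m, a = k * m ^ 2 := by
  have hdvd : 2 * c ∣ t := by
    rw [← Nat.pow_dvd_pow_iff two_ne_zero]
    exact ⟨a * k, by rw [← h]; ring⟩
  obtain ⟨s, rfl⟩ := hdvd
  have hs : a * k = s ^ 2 :=
    Nat.eq_of_mul_eq_mul_left (by positivity : 0 < 4 * c ^ 2) (by linarith)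
  obtain ⟨m, rfl⟩ := (hk.dvd_pow_iff_dvd two_ne_zero).1 ⟨a, by rw [← hs, mul_comm]⟩
  exact ⟨m, Nat.eq_of_mul_eq_mul_right (Nat.pos_of_ne_zero hk.ne_zero) (by linarith)⟩

/-- If `√a + √b = √c`, then `4ac` is a perfect square. -/
theorem Real.exists_four_mul_eq_sq_of_sqrt_add_sqrt {a b c : ℕ}
    (h : Real.sqrt a + Real.sqrt b = Real.sqrt c) : ∃ t : ℕ, 4 * a * c = t ^ 2 := by
  refine ⟨((a : ℤ) + c - b).natAbs, ?_⟩
  zify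
  rw [sq_abs]
  have ha := Real.sq_sqrt (Nat.cast_nonneg (α := ℝ) a)
  have hb := Real.sq_sqrt (Nat.cast_nonneg (α := ℝ) b)
  have hc := Real.sq_sqrt (Nat.cast_nonneg (α := ℝ) c)
  have key : (4 * a * c : ℝ) = (a + c - b) ^ 2 := by
    rw [← ha, ← hb, ← hc, ← h]
    ring
  exact_mod_cast key



/-- If `a₁, a₂, a₃` are positive integers with `√a₁ + √a₂ = √a₃`, then there exist a
squarefree positive integer `k` and positive integers `m₁, m₂, m₃` with `m₁ + m₂ = m₃`
such that `a_j = k·m_j²` for `j = 1, 2, 3`. -/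
theorem sqrt_sum_eq_sqrt_structure (a₁ a₂ a₃ : ℕ) (h₁ : 0 < a₁) (h₂ : 0 < a₂) (h₃ : 0 < a₃)
    (h : Real.sqrt a₁ + Real.sqrt a₂ = Real.sqrt a₃) :
    ∃ k m₁ m₂ m₃ : ℕ, Squarefree k ∧ 0 < k ∧ 0 < m₁ ∧ 0 < m₂ ∧ 0 < m₃ ∧
      m₁ + m₂ = m₃ ∧ a₁ = k * m₁ ^ 2 ∧ a₂ = k * m₂ ^ 2 ∧ a₃ = k * m₃ ^ 2 := by
  obtain ⟨k, m₃, hk₀, hm₃, rfl, hk⟩ := Nat.sq_mul_squarefree_of_pos h₃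
  rw [mul_comm (m₃ ^ 2) k] at *
  obtain ⟨t₁, ht₁⟩ := Real.exists_four_mul_eq_sq_of_sqrt_add_sqrt h
  obtain ⟨t₂, ht₂⟩ := Real.exists_four_mul_eq_sq_of_sqrt_add_sqrt ((add_comm _ _).trans h)
  obtain ⟨m₁, rfl⟩ := hk.exists_eq_mul_sq hm₃ ht₁
  obtain ⟨m₂, rfl⟩ := hk.exists_eq_mul_sq hm₃ ht₂
  refine ⟨k, m₁, m₂, m₃, hk, hk₀, Nat.pos_of_ne_zero ?_, Nat.pos_of_ne_zero ?_, hm₃, ?_,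
    rfl, rfl, rfl⟩
  · rintro rfl
    simp at h₁
  · rintro rfl
    simp at h₂
  · have hsqrt (m : ℕ) : Real.sqrt ((k * m ^ 2 : ℕ) : ℝ) = Real.sqrt k * m := by
      push_cast
      rw [Real.sqrt_mul (Nat.cast_nonneg k), Real.sqrt_sq (Nat.cast_nonneg m)]
    rw [hsqrt, hsqrt, hsqrt, ← mul_add] at h
    have hpos : 0 < Real.sqrt k := Real.sqrt_pos.2 (Nat.cast_pos.2 hk₀)
    exact_mod_cast mul_left_cancel₀ hpos.ne' h
end

section
/- If μ₁,ν₁,μ₂,ν₂,μ₃,ν₃ are positive integers with μ_j ≡ ν_j (mod 2) for j = 1,2,3 and √(μ₁ν₁) + √(μ₂ν₂) = √(μ₃ν₃), then ν₁ + ν₂ + ν₃ is even, i.e. (−1)^{ν₁+ν₂+ν₃} = 1. -/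
/-- If `√a + √b = √c` for natural numbers `a`, `b`, `c`, then `a + b + c` is even. -/
theorem even_add_add_of_sqrt_add_sqrt_eq {a b c : ℕ}
    (h : Real.sqrt a + Real.sqrt b = Real.sqrt c) : Even (a + b + c) := by
  have ha := Real.sq_sqrt (Nat.cast_nonneg (α := ℝ) a)
  have hb := Real.sq_sqrt (Nat.cast_nonneg (α := ℝ) b)
  have hc := Real.sq_sqrt (Nat.cast_nonneg (α := ℝ) c)
  have key : ((c : ℝ) - a - b) ^ 2 = 4 * a * b := by
    rw [← hc, ← h, ← ha, ← hb]
    simp only [Real.sqrt_sq (Real.sqrt_nonneg _)]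
    ring
  have keyZ : ((c : ℤ) - a - b) ^ 2 = 4 * a * b := by exact_mod_cast key
  have heven : Even (((c : ℤ) - a - b) ^ 2) := by
    rw [keyZ]
    exact ⟨2 * a * b, by ring⟩
  obtain ⟨k, hk⟩ := (Int.even_pow.mp heven).1
  rw [Nat.even_iff]
  omega

/-- If `m` and `n` have the same parity, then so do `m * n` and `n`. -/
theorem even_mul_iff_of_mod_two_eq {m n : ℕ} (h : m % 2 = n % 2) : Even (m * n) ↔ Even n := by
  rw [Nat.even_mul, Nat.even_iff, Nat.even_iff, h, or_self]

/-- If `μ_j ≡ ν_j (mod 2)` for `j = 1,2,3` and `√(μ₁ν₁) + √(μ₂ν₂) = √(μ₃ν₃)`, then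
`ν₁ + ν₂ + ν₃` is even, i.e. `(−1)^{ν₁+ν₂+ν₃} = 1`. -/
theorem nu_sum_even (μ₁ ν₁ μ₂ ν₂ μ₃ ν₃ : ℕ)
    (hμ₁ : 0 < μ₁) (hν₁ : 0 < ν₁) (hμ₂ : 0 < μ₂) (hν₂ : 0 < ν₂) (hμ₃ : 0 < μ₃) (hν₃ : 0 < ν₃)
    (hp₁ : μ₁ % 2 = ν₁ % 2) (hp₂ : μ₂ % 2 = ν₂ % 2) (hp₃ : μ₃ % 2 = ν₃ % 2)
    (h : Real.sqrt ((μ₁ : ℝ) * ν₁) + Real.sqrt ((μ₂ : ℝ) * ν₂) = Real.sqrt ((μ₃ : ℝ) * ν₃)) :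
    Even (ν₁ + ν₂ + ν₃) ∧ (-1 : ℝ) ^ (ν₁ + ν₂ + ν₃) = 1 := by
  have key : Even (ν₁ + ν₂ + ν₃) := by
    have hs : Even (μ₁ * ν₁ + μ₂ * ν₂ + μ₃ * ν₃) :=
      even_add_add_of_sqrt_add_sqrt_eq (by push_cast; exact h)
    simpa only [Nat.even_add, even_mul_iff_of_mod_two_eq hp₁, even_mul_iff_of_mod_two_eq hp₂,
      even_mul_iff_of_mod_two_eq hp₃] using hs
  exact ⟨key, key.neg_one_pow⟩
end

section
/- Fix γ ∈ (0,1] and α ∈ (2γ, 2), and set ε = T^{−γ}. Let F^ε_H(t) = (t^{3/4}/π) Σ_{0<ν<μ, μ≡ν (mod 2)} (−1)^ν cos(2π√t·√(μν) − π/4) μ^{−5/4} ν^{−1/4} ρ̂_ε((μ+ν)/2, ν). Then there is a constant C such that for all large T and all t ∈ [1,T], the tail obtained by restricting the sum to μν ≥ T^α has absolute value at most C·T^{1/2}; equivalently F^ε_H(t) equals the truncated sum over indices with μν < T^α up to an error O(T^{1/2}). -/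
open scoped Classical
open Real MeasureTheory

/-- The mollifier `ρ_ε(x,y) = ε⁻² ρ(x/ε, y/ε)`. -/
noncomputable def mollifier (ρ : ℝ × ℝ → ℝ) (ε : ℝ) (x : ℝ × ℝ) : ℝ :=
  ε⁻¹ ^ 2 * ρ (x.1 / ε, x.2 / ε)

/-- The Fourier transform `ρ̂_ε(ξ,η) = ∫ ρ_ε(x,y) e^{−2πi(xξ+yη)} dx dy`. -/
noncomputable def rhoHatEps (ρ : ℝ × ℝ → ℝ) (ε : ℝ) (ξ : ℝ × ℝ) : ℂ :=
  ∫ x : ℝ × ℝ, (mollifier ρ ε x : ℂ) *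
    Complex.exp (-(2 * (π : ℂ) * Complex.I) * ((x.1 * ξ.1 + x.2 * ξ.2 : ℝ) : ℂ))

/-- The general term of the sum `F^ε_H(t)` (without the factor `t^{3/4}/π`), for
indices `0 < ν < μ` with `μ ≡ ν (mod 2)`, and `0` otherwise. -/
noncomputable def Fterm (ρ : ℝ × ℝ → ℝ) (ε t : ℝ) (p : ℕ × ℕ) : ℝ :=
  if 0 < p.2 ∧ p.2 < p.1 ∧ p.1 % 2 = p.2 % 2 then
    (-1 : ℝ) ^ p.2 *
      Real.cos (2 * π * Real.sqrt t * Real.sqrt ((p.1 : ℝ) * p.2) - π / 4) *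
      (p.1 : ℝ) ^ (-(5 : ℝ) / 4) * (p.2 : ℝ) ^ (-(1 : ℝ) / 4) *
      (rhoHatEps ρ ε ((((p.1 : ℝ) + (p.2 : ℝ)) / 2), (p.2 : ℝ))).re
  else 0

/-- The standard bilinear pairing `(x, ξ) ↦ x₁ ξ₁ + x₂ ξ₂` on `ℝ × ℝ`. -/
noncomputable def dotPairing : ℝ × ℝ →L[ℝ] ℝ × ℝ →L[ℝ] ℝ :=
  (ContinuousLinearMap.mul ℝ ℝ).bilinearComp (.fst ℝ ℝ ℝ) (.fst ℝ ℝ ℝ) +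
    (ContinuousLinearMap.mul ℝ ℝ).bilinearComp (.snd ℝ ℝ ℝ) (.snd ℝ ℝ ℝ)

lemma dotPairing_apply (x ξ : ℝ × ℝ) : dotPairing x ξ = x.1 * ξ.1 + x.2 * ξ.2 := by
  simp [dotPairing]

lemma rhoHatEps_eq_fourierIntegral (ρ : ℝ × ℝ → ℝ) {ε : ℝ} (hε : 0 < ε) (ξ : ℝ × ℝ) :
    rhoHatEps ρ ε ξ = VectorFourier.fourierIntegral Real.fourierChar volume
      dotPairing.toLinearMap₁₂ (fun x ↦ (ρ x : ℂ)) (ε • ξ) := by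
  have hscale := Measure.integral_comp_inv_smul_of_nonneg volume
    (fun y : ℝ × ℝ ↦ ((ε⁻¹ ^ 2 : ℝ) : ℂ) *
      (Real.fourierChar (-dotPairing y (ε • ξ)) • (ρ y : ℂ))) hε.le
  have hfin : Module.finrank ℝ (ℝ × ℝ) = 2 := by simp
  have hone : ε ^ 2 • (∫ y : ℝ × ℝ, ((ε⁻¹ ^ 2 : ℝ) : ℂ) *
      (Real.fourierChar (-dotPairing y (ε • ξ)) • (ρ y : ℂ))) =
      ∫ y : ℝ × ℝ, Real.fourierChar (-dotPairing y (ε • ξ)) • (ρ y : ℂ) := by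
    rw [integral_const_mul, Complex.real_smul, ← mul_assoc, ← Complex.ofReal_mul, ← mul_pow,
      mul_inv_cancel₀ hε.ne']
    simp
  rw [hfin, hone] at hscale
  refine Eq.trans ?_ hscale
  refine integral_congr_ae (.of_forall fun x ↦ ?_)
  have harg : dotPairing (ε⁻¹ • x) (ε • ξ) = x.1 * ξ.1 + x.2 * ξ.2 := by
    simp only [dotPairing_apply, Prod.smul_fst, Prod.smul_snd, smul_eq_mul]
    field_simp
  have hx : (x.1 / ε, x.2 / ε) = ε⁻¹ • x := by
    ext <;> simp [div_eq_inv_mul]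
  simp only [mollifier, harg, hx, Circle.smul_def, Real.fourierChar_apply, smul_eq_mul]
  push_cast
  ring_nf

/-- The Fourier transform of a smooth bump, rescaled by `ε`, decays faster than any power of
`ε ξ₁`, uniformly in `ε`. -/
lemma exists_pow_mul_norm_rhoHatEps_le {ρ : ℝ × ℝ → ℝ} (hsmooth : ContDiff ℝ (⊤ : ℕ∞) ρ)
    (hsupp : HasCompactSupport ρ) (N : ℕ) :
    ∃ C : ℝ, ∀ ε : ℝ, 0 < ε → ∀ ξ : ℝ × ℝ, |ε * ξ.1| ^ N * ‖rhoHatEps ρ ε ξ‖ ≤ C := by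
  have hf : ContDiff ℝ (⊤ : ℕ∞) (fun x ↦ (ρ x : ℂ)) := Complex.ofRealCLM.contDiff.comp hsmooth
  have hfs : HasCompactSupport (fun x ↦ (ρ x : ℂ)) :=
    hsupp.comp_left (g := ((↑) : ℝ → ℂ)) Complex.ofReal_zero
  have hint (k n : ℕ) (_ : (k : ℕ∞) ≤ (⊤ : ℕ∞)) (_ : (n : ℕ∞) ≤ (⊤ : ℕ∞)) :
      Integrable (fun v ↦ ‖v‖ ^ k * ‖iteratedFDeriv ℝ n (fun x ↦ (ρ x : ℂ)) v‖) := by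
    have hcont : Continuous (iteratedFDeriv ℝ n (fun x ↦ (ρ x : ℂ))) :=
      hf.continuous_iteratedFDeriv (mod_cast le_top)
    exact Continuous.integrable_of_hasCompactSupport (by fun_prop)
      (hfs.iteratedFDeriv n).norm.mul_left
  have key (w : ℝ × ℝ) := VectorFourier.pow_mul_norm_iteratedFDeriv_fourierIntegral_le dotPairing
    hf hint (k := 0) (n := N) le_top le_top (1, 0) w
  refine ⟨_, fun ε hε ξ ↦ le_trans (le_of_eq ?_) (key (ε • ξ))⟩
  rw [norm_iteratedFDeriv_zero, ← rhoHatEps_eq_fourierIntegral ρ hε, dotPairing_apply]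
  simp only [Prod.smul_fst, smul_eq_mul, one_mul, zero_mul, add_zero]

lemma abs_Fterm_le (ρ : ℝ × ℝ → ℝ) (ε t : ℝ) {p : ℕ × ℕ} (h0 : 0 < p.2) (h1 : p.2 < p.1) :
    |Fterm ρ ε t p| ≤ ‖rhoHatEps ρ ε ((((p.1 : ℝ) + (p.2 : ℝ)) / 2), (p.2 : ℝ))‖ := by
  unfold Fterm
  split_ifs
  · have hμ : (1 : ℝ) ≤ p.1 := mod_cast (by lia : 1 ≤ p.1)
    have hν : (1 : ℝ) ≤ p.2 := mod_cast h0
    simp only [abs_mul, abs_pow, abs_neg, abs_one, one_pow, one_mul]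
    rw [abs_of_nonneg (rpow_nonneg (zero_le_one.trans hμ) _),
      abs_of_nonneg (rpow_nonneg (zero_le_one.trans hν) _)]
    refine (mul_le_of_le_one_left (abs_nonneg _) ?_).trans (Complex.abs_re_le_norm _)
    refine mul_le_one₀ (mul_le_one₀ (abs_cos_le_one _) (by positivity) ?_) (by positivity) ?_
    · exact rpow_le_one_of_one_le_of_nonpos hμ (by norm_num)
    · exact rpow_le_one_of_one_le_of_nonpos hν (by norm_num)
  · simp

/-- In the range `μν ≥ T^α`, rapid decay at scale `T^γ` beats any fixed power of `T` and `μ`. -/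
lemma le_of_pow_mul_le {γ α T C r μ ν : ℝ} {M : ℕ} (hM : 3 * γ + 1 ≤ (α / 2 - γ) * M)
    (hT : 1 ≤ T) (hν : 0 < ν) (hνμ : ν ≤ μ) (hα : T ^ α ≤ μ * ν) (hr : 0 ≤ r)
    (hC : |T ^ (-γ) * ((μ + ν) / 2)| ^ (M + 3) * r ≤ C) :
    r ≤ 2 ^ (M + 3) * C * T⁻¹ * (μ ^ (-(3 : ℝ) / 2) * ν ^ (-(3 : ℝ) / 2)) := by
  have hT0 : 0 < T := by linarith
  have hμ : 0 < μ := hν.trans_le hνμ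
  have hμT : T ^ (α / 2) ≤ μ := by
    refine le_of_sq_le_sq ?_ hμ.le
    rw [← rpow_natCast, ← rpow_mul hT0.le]
    norm_num
    nlinarith
  have hpow : T * T ^ (γ * (M + 3)) ≤ μ ^ M := by
    calc T * T ^ (γ * (M + 3)) = T ^ (1 + γ * (M + 3)) := by rw [rpow_add hT0, rpow_one]
      _ ≤ T ^ (α / 2 * M) := rpow_le_rpow_of_exponent_le hT (by linarith)
      _ = (T ^ (α / 2)) ^ M := by rw [rpow_mul hT0.le, rpow_natCast]
      _ ≤ μ ^ M := by gcongr
  have hdecay : (T ^ (-γ) * (μ / 2)) ^ (M + 3) * r ≤ C := by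
    refine le_trans ?_ hC
    rw [abs_of_pos (by positivity)]
    gcongr
    linarith
  have hTγ : (T ^ (-γ)) ^ (M + 3) * T ^ (γ * (M + 3)) = 1 := by
    rw [← rpow_natCast, ← rpow_mul hT0.le, ← rpow_add hT0]
    push_cast
    ring_nf
    exact rpow_zero T
  have hcube : μ ^ (3 : ℕ) * r ≤ 2 ^ (M + 3) * C * T⁻¹ := by
    rw [← div_eq_mul_inv, le_div_iff₀ hT0]
    calc μ ^ 3 * r * T
        = (T ^ (-γ)) ^ (M + 3) * μ ^ 3 * r * (T * T ^ (γ * (M + 3))) := by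
          linear_combination (-(μ ^ 3 * r * T)) * hTγ
      _ ≤ (T ^ (-γ)) ^ (M + 3) * μ ^ 3 * r * μ ^ M := by gcongr
      _ = 2 ^ (M + 3) * ((T ^ (-γ) * (μ / 2)) ^ (M + 3) * r) := by
          rw [mul_pow, div_pow]
          field_simp
          ring
      _ ≤ 2 ^ (M + 3) * C := by gcongr
  have hrpow : μ ^ (-(3 : ℝ)) ≤ μ ^ (-(3 : ℝ) / 2) * ν ^ (-(3 : ℝ) / 2) := by
    calc μ ^ (-(3 : ℝ)) = μ ^ (-(3 : ℝ) / 2) * μ ^ (-(3 : ℝ) / 2) := by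
          rw [← rpow_add hμ]
          norm_num
      _ ≤ _ := mul_le_mul_of_nonneg_left
          (rpow_le_rpow_of_nonpos hν hνμ (by norm_num)) (by positivity)
  have hinv : μ ^ (3 : ℕ) * μ ^ (-(3 : ℝ)) = 1 := by
    rw [← rpow_natCast, ← rpow_add hμ]
    norm_num
  calc r = μ ^ (3 : ℕ) * r * μ ^ (-(3 : ℝ)) := by linear_combination (-r) * hinv
    _ ≤ μ ^ (3 : ℕ) * r * (μ ^ (-(3 : ℝ) / 2) * ν ^ (-(3 : ℝ) / 2)) := by gcongr
    _ ≤ _ := by gcongr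

/-- Truncation of `F^ε_H(t)`: the tail of the sum over indices with `μν ≥ T^α` is
`O(T^{1/2})`, uniformly for `t ∈ [1,T]`. -/
theorem truncation_tail_bound (ρ : ℝ × ℝ → ℝ)
    (hsmooth : ContDiff ℝ (⊤ : ℕ∞) ρ) (hpos : ∀ x, 0 ≤ ρ x)
    (hsym : ∀ x : ℝ × ℝ, ρ (-x.1, -x.2) = ρ x)
    (hsupp : Function.support ρ ⊆ Set.Icc (-1, -1) (1, 1))
    (hint : ∫ x : ℝ × ℝ, ρ x = 1)
    (γ α : ℝ) (hγ0 : 0 < γ) (hγ1 : γ ≤ 1) (hα1 : 2 * γ < α) (hα2 : α < 2) :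
    ∃ C : ℝ, 0 < C ∧ ∃ T₀ : ℝ, ∀ T : ℝ, T₀ ≤ T → ∀ t : ℝ, 1 ≤ t → t ≤ T →
      |(t ^ ((3 : ℝ) / 4) / π) *
          ∑' p : ℕ × ℕ,
            (if T ^ α ≤ ((p.1 : ℝ) * p.2) then Fterm ρ (T ^ (-γ)) t p else 0)| ≤
        C * T ^ ((1 : ℝ) / 2) := by
  have hcs : HasCompactSupport ρ :=
    HasCompactSupport.intro isCompact_Icc fun x hx ↦ by
      by_contra h
      exact hx (hsupp h)
  obtain ⟨M, hM⟩ := exists_nat_ge ((3 * γ + 1) / (α / 2 - γ))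
  rw [div_le_iff₀' (by linarith)] at hM
  obtain ⟨C, hC⟩ := exists_pow_mul_norm_rhoHatEps_le hsmooth hcs (M + 3)
  have hC0 : 0 ≤ C := le_trans (by positivity) (hC 1 one_pos 0)
  have hsum : Summable fun n : ℕ ↦ (n : ℝ) ^ (-(3 : ℝ) / 2) :=
    summable_nat_rpow.2 (by norm_num)
  have hsum2 : Summable fun p : ℕ × ℕ ↦ (p.1 : ℝ) ^ (-(3 : ℝ) / 2) * (p.2 : ℝ) ^ (-(3 : ℝ) / 2) :=
    hsum.mul_of_nonneg hsum (fun _ ↦ by positivity) fun _ ↦ by positivity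
  set S := ∑' p : ℕ × ℕ, (p.1 : ℝ) ^ (-(3 : ℝ) / 2) * (p.2 : ℝ) ^ (-(3 : ℝ) / 2)
  have hS : 0 ≤ S := tsum_nonneg fun _ ↦ by positivity
  refine ⟨2 ^ (M + 3) * C * S + 1, by positivity, 1, fun T hT t ht1 htT ↦ ?_⟩
  have hT0 : 0 < T := by linarith
  have hbound : ‖∑' p : ℕ × ℕ,
      (if T ^ α ≤ ((p.1 : ℝ) * p.2) then Fterm ρ (T ^ (-γ)) t p else 0)‖ ≤
      2 ^ (M + 3) * C * T⁻¹ * S := by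
    refine tsum_of_norm_bounded (hsum2.hasSum.mul_left _) fun p ↦ ?_
    split_ifs with hp
    · by_cases hc : 0 < p.2 ∧ p.2 < p.1
      · have hν : (0 : ℝ) < p.2 := mod_cast hc.1
        have hνμ : (p.2 : ℝ) ≤ p.1 := mod_cast hc.2.le
        have hdecay := hC (T ^ (-γ)) (by positivity) (((p.1 : ℝ) + (p.2 : ℝ)) / 2, (p.2 : ℝ))
        exact (abs_Fterm_le ρ _ t hc.1 hc.2).trans
          (le_of_pow_mul_le hM hT hν hνμ hp (norm_nonneg _) hdecay)
      · rw [Fterm, if_neg fun h ↦ hc ⟨h.1, h.2.1⟩, norm_zero]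
        positivity
    · rw [norm_zero]
      positivity
  have hpre : t ^ ((3 : ℝ) / 4) / π ≤ T ^ ((3 : ℝ) / 4) :=
    (div_le_self (by positivity) (by linarith [pi_gt_three])).trans
      (rpow_le_rpow (by linarith) htT (by norm_num))
  have hexp : T ^ ((3 : ℝ) / 4) * T⁻¹ ≤ T ^ ((1 : ℝ) / 2) := by
    rw [← rpow_neg_one, ← rpow_add hT0]
    exact rpow_le_rpow_of_exponent_le hT (by norm_num)
  rw [abs_mul, abs_of_nonneg (show 0 ≤ t ^ ((3 : ℝ) / 4) / π by positivity)]
  calc _ ≤ T ^ ((3 : ℝ) / 4) * (2 ^ (M + 3) * C * T⁻¹ * S) := by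
        gcongr
        exact hbound
    _ = 2 ^ (M + 3) * C * S * (T ^ ((3 : ℝ) / 4) * T⁻¹) := by ring
    _ ≤ 2 ^ (M + 3) * C * S * T ^ ((1 : ℝ) / 2) := by gcongr
    _ ≤ _ := by gcongr; linarith
end

section
/- The triple series Σ_{k≥1} Σ_{m₁≥1} Σ_{m₂≥1} k^{−7/4} · m₁^{−3/2} · m₂^{−3/2} · (m₁+m₂)^{−1/2} · d(k·m₁²) · d(k·m₂²) converges, where d(n) denotes the number of positive divisors of n. -/
open scoped Pointwise in
/-- The divisor-counting function is submultiplicative. -/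
theorem Nat.card_divisors_mul_le (m n : ℕ) :
    (m * n).divisors.card ≤ m.divisors.card * n.divisors.card := by
  rw [Nat.divisors_mul]
  exact Finset.card_mul_le

/-- A nonnegative series over products of pairs is the divisor-weighted series. -/
theorem summable_card_divisors_mul_of_summable_mul {f : ℕ+ → ℝ} (hf : ∀ n, 0 ≤ f n)
    (h : Summable fun p : ℕ+ × ℕ+ => f (p.1 * p.2)) :
    Summable fun n : ℕ+ => ((n : ℕ).divisors.card : ℝ) * f n := by
  rw [← sigmaAntidiagonalEquivProd.summable_iff] at h
  have key : ∀ x : (Σ n : ℕ+, Nat.divisorsAntidiagonal n),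
      f ((sigmaAntidiagonalEquivProd x).1 * (sigmaAntidiagonalEquivProd x).2) = f x.1 := by
    rintro ⟨n, x⟩
    congr 1
    exact PNat.eq (divisorsAntidiagonalFactors_eq x)
  have h' := ((summable_sigma_of_nonneg fun x => hf x.1).mp (h.congr fun x => key x)).2
  refine h'.congr fun n => ?_
  simp [tsum_fintype, ← Nat.map_div_right_divisors]

/-- For a nonnegative summable completely multiplicative `f`, the series `∑ d(n)² f(n)` converges. -/
theorem summable_card_divisors_sq_mul {f : ℕ+ → ℝ} (hf : ∀ n, 0 ≤ f n)
    (hmul : ∀ m n, f (m * n) = f m * f n) (hs : Summable f) :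
    Summable fun n : ℕ+ => ((n : ℕ).divisors.card : ℝ) ^ 2 * f n := by
  have h₁ : Summable fun n : ℕ+ => ((n : ℕ).divisors.card : ℝ) * f n :=
    summable_card_divisors_mul_of_summable_mul hf <| by
      simpa only [hmul] using hs.mul_of_nonneg hs hf hf
  have hnn : ∀ n : ℕ+, 0 ≤ ((n : ℕ).divisors.card : ℝ) * f n :=
    fun n => mul_nonneg (Nat.cast_nonneg _) (hf n)
  have h₂ := summable_card_divisors_mul_of_summable_mul hnn <|
    (h₁.mul_of_nonneg h₁ hnn hnn).of_nonneg_of_le (fun p => hnn _) fun p => by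
      have : (((p.1 * p.2 : ℕ+) : ℕ).divisors.card : ℝ) ≤
          ((p.1 : ℕ).divisors.card : ℝ) * ((p.2 : ℕ).divisors.card : ℝ) := by
        exact_mod_cast Nat.card_divisors_mul_le p.1 p.2
      calc _ ≤ ((p.1 : ℕ).divisors.card : ℝ) * ((p.2 : ℕ).divisors.card : ℝ) *
            f (p.1 * p.2) := mul_le_mul_of_nonneg_right this (hf _)
        _ = _ := by rw [hmul]; ring
  exact h₂.congr fun n => by ring

/-- The series `∑ d(n)² n^s` converges for `s < -1`. -/
theorem summable_card_divisors_sq_mul_rpow {s : ℝ} (hs : s < -1) :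
    Summable fun n : ℕ => ((n + 1).divisors.card : ℝ) ^ 2 * ((n + 1 : ℕ) : ℝ) ^ s := by
  have h := summable_card_divisors_sq_mul (f := fun n : ℕ+ => ((n : ℕ) : ℝ) ^ s)
    (fun n => by positivity)
    (fun m n => by
      rw [PNat.mul_coe, Nat.cast_mul, Real.mul_rpow (Nat.cast_nonneg _) (Nat.cast_nonneg _)])
    ((Real.summable_nat_rpow.mpr hs).comp_injective PNat.coe_injective)
  exact (summable_pnat_iff_summable_succ
    (f := fun n : ℕ => (n.divisors.card : ℝ) ^ 2 * (n : ℝ) ^ s)).mp h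

/-- The series
`Σ_{k,m₁,m₂ ≥ 1} k^{−7/4} m₁^{−3/2} m₂^{−3/2} (m₁+m₂)^{−1/2} d(km₁²) d(km₂²)` converges. -/
theorem residual_triple_series_summable :
    Summable (fun p : ℕ × ℕ × ℕ =>
      ((p.1 + 1 : ℕ) : ℝ) ^ (-(7 : ℝ) / 4) *
      ((p.2.1 + 1 : ℕ) : ℝ) ^ (-(3 : ℝ) / 2) *
      ((p.2.2 + 1 : ℕ) : ℝ) ^ (-(3 : ℝ) / 2) *
      ((p.2.1 + 1 + (p.2.2 + 1) : ℕ) : ℝ) ^ (-(1 : ℝ) / 2) *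
      ((Nat.divisors ((p.1 + 1) * (p.2.1 + 1) ^ 2)).card : ℝ) *
      ((Nat.divisors ((p.1 + 1) * (p.2.2 + 1) ^ 2)).card : ℝ)) := by
  have hk := summable_card_divisors_sq_mul_rpow (s := -(7 : ℝ) / 4) (by norm_num)
  have hm := summable_card_divisors_sq_mul_rpow (s := -(3 : ℝ) / 2) (by norm_num)
  have hmm := hm.mul_of_nonneg hm (fun n => by positivity) (fun n => by positivity)
  have hkmm := hk.mul_of_nonneg hmm (fun n => by positivity) (fun n => by positivity)
  refine hkmm.of_nonneg_of_le (fun p => by positivity) ?_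
  rintro ⟨k, m, n⟩
  have hd : ∀ j : ℕ, (((k + 1) * (j + 1) ^ 2).divisors.card : ℝ) ≤
      ((k + 1).divisors.card : ℝ) * ((j + 1).divisors.card : ℝ) ^ 2 := fun j => by
    have h₁ := Nat.card_divisors_mul_le (k + 1) ((j + 1) ^ 2)
    have h₂ := Nat.card_divisors_mul_le (j + 1) (j + 1)
    rw [← sq, ← sq] at h₂
    exact_mod_cast h₁.trans (Nat.mul_le_mul_left _ h₂)
  have hle : ((m + 1 + (n + 1) : ℕ) : ℝ) ^ (-(1 : ℝ) / 2) ≤ 1 :=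
    Real.rpow_le_one_of_one_le_of_nonpos (by exact_mod_cast (by omega)) (by norm_num)
  calc _ ≤ ((k + 1 : ℕ) : ℝ) ^ (-(7 : ℝ) / 4) * ((m + 1 : ℕ) : ℝ) ^ (-(3 : ℝ) / 2) *
        ((n + 1 : ℕ) : ℝ) ^ (-(3 : ℝ) / 2) * 1 *
        (((k + 1).divisors.card : ℝ) * ((m + 1).divisors.card : ℝ) ^ 2) *
        (((k + 1).divisors.card : ℝ) * ((n + 1).divisors.card : ℝ) ^ 2) := by
        gcongr
        · exact hd m
        · exact hd n
    _ = _ := by ring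
end
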